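/- Let S be a supercharacter theory of a finite group G and let g ∈ G. Then g is an S-Camina element if and only if |Cl_S(g)| = |[G,S]|. -/

import Mathlib

open scoped BigOperators Pointwise

/-- `f : G → ℂ` is an irreducible character of `G`. -/
def IsIrrChar (G : Type) [Group G] [Fintype G] (f : G → ℂ) : Prop :=
  ∃ V : FDRep ℂ G, CategoryTheory.Simple V ∧ V.character = f

/-- A supercharacter theory of a finite group `G` (Diaconis–Isaacs): a partition
`parts` of the set of irreducible characters of `G` together with a partition of `G`
into `S`-classes (`cls g` is the class of `g`), such that `{1}` is a class, the number
of parts equals the number of classes, and each supercharacter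
`σ_X = ∑ χ ∈ X, χ(1)·χ` is constant on every class. -/
structure SCT (G : Type) [Group G] [Fintype G] where
  parts : Finset (Finset (G → ℂ))
  cls : G → Set G
  parts_cover : ∀ f : G → ℂ, IsIrrChar G f ↔ ∃ X ∈ parts, f ∈ X
  parts_disj : ∀ X ∈ parts, ∀ Y ∈ parts, X ≠ Y → Disjoint X Y
  parts_nonempty : ∀ X ∈ parts, X.Nonempty
  mem_cls : ∀ g : G, g ∈ cls g
  cls_eq : ∀ g h : G, h ∈ cls g → cls h = cls g
  cls_one : cls (1 : G) = {1}
  card_eq : parts.card = Nat.card (Set.range cls)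
  const : ∀ X ∈ parts, ∀ g h : G, h ∈ cls g →
    (∑ χ ∈ X, χ 1 * χ h) = (∑ χ ∈ X, χ 1 * χ g)

variable {G : Type} [Group G] [Fintype G]

namespace SCT

/-- The supercharacter attached to a part `X`. -/
noncomputable def superchar (_S : SCT G) (X : Finset (G → ℂ)) : G → ℂ := fun g => ∑ χ ∈ X, χ 1 * χ g

/-- The set `Irr(S)` of `S`-characters. -/
def Irr (S : SCT G) : Set (G → ℂ) := {f | ∃ X ∈ S.parts, f = S.superchar X}

end SCT

/-- The kernel of a character-like function `f : G → ℂ`. -/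
def charKer (f : G → ℂ) : Subgroup G where
  carrier := {g | ∀ h, f (g * h) = f h}
  one_mem' := by intro h; simp
  mul_mem' := by intro a b ha hb h; rw [mul_assoc, ha, hb]
  inv_mem' := by
    intro a ha h
    have := ha (a⁻¹ * h)
    rw [mul_inv_cancel_left] at this
    exact this.symm

namespace SCT

/-- `[H,S]`, the subgroup generated by the `g⁻¹k` with `g ∈ H`, `k ∈ Cl_S(g)`. -/
def comm (S : SCT G) (H : Subgroup G) : Subgroup G :=
  Subgroup.closure {x | ∃ g ∈ H, ∃ k ∈ S.cls g, x = g⁻¹ * k}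

/-- `[G,S]`. -/
def derived (S : SCT G) : Subgroup G := S.comm ⊤

/-- `Irr(S | N)`: the `S`-characters whose kernel does not contain `N`. -/
def IrrRel (S : SCT G) (N : Subgroup G) : Set (G → ℂ) :=
  {f | f ∈ S.Irr ∧ ¬ N ≤ charKer f}

/-- `g` is an `S`-Camina element: all of `Irr(S | [G,S])` vanishes at `g`. -/
def IsCaminaElt (S : SCT G) (g : G) : Prop :=
  ∀ f ∈ S.IrrRel S.derived, f g = 0

/-- `N` is `S`-normal: a union of `S`-classes. -/
def IsNormal (S : SCT G) (N : Subgroup G) : Prop :=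
  ∀ g ∈ N, S.cls g ⊆ N

/-- `(G,N)` is a generalised `S`-Camina pair. -/
def IsGCP (S : SCT G) (N : Subgroup G) : Prop :=
  S.IsNormal N ∧ ∀ g : G, g ∉ N → S.IsCaminaElt g

/-- The set `Z(S)` of elements with singleton `S`-class. -/
def centerSet (S : SCT G) : Set G := {g | S.cls g = {g}}

/-- The vanishing-off subgroup `V(S | N)`. -/
def V (S : SCT G) (N : Subgroup G) : Subgroup G :=
  Subgroup.closure {g | ∃ f ∈ S.IrrRel N, f g ≠ 0}

/-- `V(S) = V(S | [G,S])`. -/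
def VS (S : SCT G) : Subgroup G := S.V S.derived

/-- `U(S | N)`: the product of all `S`-normal subgroups `H` with `V(S | H) ≤ N`. -/
def U (S : SCT G) (N : Subgroup G) : Subgroup G :=
  ⨆ (H : Subgroup G) (_ : S.IsNormal H ∧ S.V H ≤ N), H

/-- The upper `S`-central series: `ζ_0 = 1` and `ζ_{i+1}/ζ_i = Z(S^{G/ζ_i})`,
i.e. `ζ_{i+1}` consists of the `g` whose `S`-class maps onto the single coset `gζ_i`. -/
def zeta (S : SCT G) : ℕ → Subgroup G
  | 0 => ⊥
  | i + 1 => Subgroup.closure {g | ∀ k ∈ S.cls g, g⁻¹ * k ∈ S.zeta i}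

/-- The lower `S`-central series `γ_1 = G`, `γ_{i+1} = [γ_i, S]` (with `γ_0 := G`). -/
def gamma (S : SCT G) : ℕ → Subgroup G
  | 0 => ⊤
  | 1 => ⊤
  | n + 2 => S.comm (S.gamma (n + 1))

/-- The series `V_1(S) = V(S)`, `V_{i+1}(S) = [V_i(S), S]` (with `V_0 := V(S)`). -/
def Vseq (S : SCT G) : ℕ → Subgroup G
  | 0 => S.VS
  | 1 => S.VS
  | n + 2 => S.comm (S.Vseq (n + 1))

/-- `G` is a `VZ(S)`-group: every member of `Irr(S | [G,S])` vanishes off `Z(S)`. -/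
def IsVZ (S : SCT G) : Prop :=
  ∀ f ∈ S.IrrRel S.derived, ∀ g : G, g ∉ S.centerSet → f g = 0

end SCT

/-- First orthogonality relation for irreducible characters, stated for functions. -/
theorem IsIrrChar.sum_mul_inv {χ ψ : G → ℂ} (hχ : IsIrrChar G χ) (hψ : IsIrrChar G ψ) :
    ∑ g, χ g * ψ g⁻¹ = if χ = ψ then (Nat.card G : ℂ) else 0 := by
  classical
  obtain ⟨V, hV, rfl⟩ := hχ
  obtain ⟨W, hW, rfl⟩ := hψ
  have hG : (Nat.card G : ℂ) ≠ 0 := Nat.cast_ne_zero.2 Nat.card_pos.ne'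
  have : Invertible (Nat.card G : ℂ) := invertibleOfNonzero hG
  have key : ∀ U : FDRep ℂ G, CategoryTheory.Simple U →
      (Nat.card G : ℂ)⁻¹ * ∑ g, U.character g * U.character g⁻¹ = 1 := fun U hU => by
    rw [FDRep.char_orthonormal, if_pos ⟨CategoryTheory.Iso.refl U⟩]
  split_ifs with h
  · have := key V hV
    rw [← h]
    field_simp at this
    exact this
  · have := FDRep.char_orthonormal V W
    rw [if_neg fun ⟨i⟩ => h (FDRep.char_iso i)] at this
    simpa [hG] using this

theorem IsIrrChar.exists_apply_one {χ : G → ℂ} (hχ : IsIrrChar G χ) :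
    ∃ n : ℕ, 0 < n ∧ χ 1 = n := by
  have horth := hχ.sum_mul_inv hχ
  obtain ⟨V, hV, rfl⟩ := hχ
  refine ⟨Module.finrank ℂ V, Nat.pos_of_ne_zero fun h => ?_, V.char_one⟩
  have hsub : Subsingleton V := Module.finrank_zero_iff.1 h
  have hz : ∀ g, V.character g = 0 := fun g => by
    have : V.ρ g = 0 := Subsingleton.elim _ _
    simp [FDRep.character, this]
  simp only [hz, zero_mul, Finset.sum_const_zero, if_true] at horth
  exact Nat.card_pos.ne' (Nat.cast_eq_zero.1 horth.symm)

theorem IsIrrChar.conj {χ : G → ℂ} (hχ : IsIrrChar G χ) (g h : G) : χ (h * g * h⁻¹) = χ g := by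
  obtain ⟨V, hV, rfl⟩ := hχ
  exact V.char_conj g h

/-- Linear characters are irreducible. -/
theorem isIrrChar_of_monoidHom (l : G →* ℂ) : IsIrrChar G l := by
  let ρ : Representation ℂ G ℂ := (Algebra.lmul ℂ ℂ).toMonoidHom.comp l
  have hρ : (FDRep.of ρ).character = l := by
    ext g
    have h : ρ g = l g • LinearMap.id := by
      ext
      simp [ρ]
    change LinearMap.trace ℂ ℂ (ρ g) = l g
    rw [h, map_smul, LinearMap.trace_id]
    simp
  refine ⟨FDRep.of ρ, ?_, hρ⟩
  rw [FDRep.simple_iff_char_is_norm_one, hρ]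
  simp only [← map_mul, mul_inv_cancel, map_one, Finset.sum_const, nsmul_eq_mul, mul_one,
    Finset.card_univ, Nat.card_eq_fintype_card]

namespace SCT

variable (S : SCT G)

theorem isIrrChar_of_mem {X : Finset (G → ℂ)} (hX : X ∈ S.parts) {χ : G → ℂ} (hχ : χ ∈ X) :
    IsIrrChar G χ :=
  (S.parts_cover χ).2 ⟨X, hX, hχ⟩

theorem sum_char_mul_superchar_inv {χ : G → ℂ} (hχ : IsIrrChar G χ) {Z : Finset (G → ℂ)}
    (hZ : Z ∈ S.parts) [Decidable (χ ∈ Z)] :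
    ∑ g, χ g * S.superchar Z g⁻¹ = if χ ∈ Z then (Nat.card G : ℂ) * χ 1 else 0 := by
  classical
  have h : ∀ ψ ∈ Z, ∑ g, χ g * (ψ 1 * ψ g⁻¹) = if χ = ψ then (Nat.card G : ℂ) * ψ 1 else 0 := by
    intro ψ hψ
    have := hχ.sum_mul_inv (S.isIrrChar_of_mem hZ hψ)
    calc ∑ g, χ g * (ψ 1 * ψ g⁻¹) = (∑ g, χ g * ψ g⁻¹) * ψ 1 := by
          rw [Finset.sum_mul]
          exact Finset.sum_congr rfl fun _ _ => by ring
      _ = _ := by rw [this, ite_mul, zero_mul]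
  simp only [superchar, Finset.mul_sum]
  rw [Finset.sum_comm, Finset.sum_congr rfl h, Finset.sum_ite_eq]
  congr

theorem superchar_one_ne_zero {X : Finset (G → ℂ)} (hX : X ∈ S.parts) :
    S.superchar X 1 ≠ 0 := by
  choose! n hn using fun χ (h : χ ∈ X) => (S.isIrrChar_of_mem hX h).exists_apply_one
  have h : S.superchar X 1 = ((∑ χ ∈ X, n χ * n χ : ℕ) : ℂ) := by
    rw [Nat.cast_sum]
    refine Finset.sum_congr rfl fun χ h => ?_
    rw [(hn χ h).2, Nat.cast_mul]
  rw [h, Nat.cast_ne_zero]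
  exact (Finset.sum_pos (fun χ h => Nat.mul_pos (hn χ h).1 (hn χ h).1)
    (S.parts_nonempty X hX)).ne'

theorem eq_of_mem_of_mem {X Z : Finset (G → ℂ)} (hX : X ∈ S.parts) (hZ : Z ∈ S.parts)
    {χ : G → ℂ} (h₁ : χ ∈ X) (h₂ : χ ∈ Z) : X = Z := by
  by_contra h
  exact Finset.disjoint_left.1 (S.parts_disj X hX Z hZ h) h₁ h₂

theorem sum_superchar_mul_superchar_inv {X Z : Finset (G → ℂ)} (hX : X ∈ S.parts)
    (hZ : Z ∈ S.parts) [Decidable (X = Z)] :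
    ∑ g, S.superchar X g * S.superchar Z g⁻¹ =
      if X = Z then (Nat.card G : ℂ) * S.superchar X 1 else 0 := by
  classical
  calc ∑ g, S.superchar X g * S.superchar Z g⁻¹
      = ∑ χ ∈ X, χ 1 * ∑ g, χ g * S.superchar Z g⁻¹ := by
        simp only [Finset.mul_sum]
        rw [Finset.sum_comm]
        refine Finset.sum_congr rfl fun g _ => ?_
        rw [superchar, Finset.sum_mul]
        exact Finset.sum_congr rfl fun _ _ => by ring
    _ = ∑ χ ∈ X, χ 1 * (if χ ∈ Z then (Nat.card G : ℂ) * χ 1 else 0) :=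
        Finset.sum_congr rfl fun χ h => by
          rw [S.sum_char_mul_superchar_inv (S.isIrrChar_of_mem hX h) hZ]
    _ = _ := by
        split_ifs with h
        · subst h
          rw [superchar, Finset.mul_sum]
          refine Finset.sum_congr rfl fun χ h => ?_
          rw [if_pos h]
          ring
        · refine Finset.sum_eq_zero fun χ hχ => ?_
          rw [if_neg fun hχZ => h (S.eq_of_mem_of_mem hX hZ hχ hχZ), mul_zero]

/-- A combination of supercharacters that is orthogonal to all of them has zero coefficients. -/
theorem coeff_eq_zero {a : S.parts → ℂ}
    (h : ∀ Z ∈ S.parts, ∑ g, (∑ X : S.parts, a X * S.superchar X g) * S.superchar Z g⁻¹ = 0)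
    (Z : S.parts) : a Z = 0 := by
  classical
  have hZ := h Z Z.2
  simp only [Finset.sum_mul] at hZ
  rw [Finset.sum_comm] at hZ
  simp only [mul_assoc, ← Finset.mul_sum] at hZ
  simp only [S.sum_superchar_mul_superchar_inv (Subtype.prop _) Z.2, Subtype.coe_inj] at hZ
  simpa [S.superchar_one_ne_zero Z.2] using hZ

theorem superchar_cls {X : Finset (G → ℂ)} (hX : X ∈ S.parts) {g h : G} (hh : h ∈ S.cls g) :
    S.superchar X h = S.superchar X g :=
  S.const X hX g h hh

/-- The supercharacters span the functions that are constant on the classes. -/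
theorem exists_eq_sum_superchar {f : G → ℂ} (hf : ∀ g, ∀ h ∈ S.cls g, f h = f g) :
    ∃ a : S.parts → ℂ, ∀ g, f g = ∑ X : S.parts, a X * S.superchar X g := by
  classical
  let rep : Set.range S.cls → G := fun q => q.2.choose
  have hrep : ∀ q, S.cls (rep q) = q := fun q => q.2.choose_spec
  have hmem : ∀ g, rep ⟨S.cls g, g, rfl⟩ ∈ S.cls g := fun g => by
    have := S.mem_cls (rep ⟨S.cls g, g, rfl⟩)
    rwa [hrep] at this
  let b : S.parts → Set.range S.cls → ℂ := fun X q => S.superchar X (rep q)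
  have hb : ∀ X g, b X ⟨S.cls g, g, rfl⟩ = S.superchar X g := fun X g =>
    S.superchar_cls X.2 (hmem g)
  have hli : LinearIndependent ℂ b := by
    rw [Fintype.linearIndependent_iff]
    intro a ha
    refine S.coeff_eq_zero fun Z _ => Finset.sum_eq_zero fun g _ => ?_
    have := congrFun ha ⟨S.cls g, g, rfl⟩
    simp only [Finset.sum_apply, Pi.smul_apply, smul_eq_mul, hb, Pi.zero_apply] at this
    rw [this, zero_mul]
  have hspan := hli.span_eq_top_of_card_eq_finrank' (by
    rw [Module.finrank_fintype_fun_eq_card, Fintype.card_coe, S.card_eq, Nat.card_eq_fintype_card])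
  have hmemf : (fun q => f (rep q)) ∈ Submodule.span ℂ (Set.range b) := hspan ▸ Submodule.mem_top
  obtain ⟨a, ha⟩ := (Submodule.mem_span_range_iff_exists_fun ℂ).1 hmemf
  refine ⟨a, fun g => ?_⟩
  have := congrFun ha ⟨S.cls g, g, rfl⟩
  simp only [Finset.sum_apply, Pi.smul_apply, smul_eq_mul, hb] at this
  rw [this, hf g _ (hmem g)]

theorem conj_mem_cls (x y : G) : x * y * x⁻¹ ∈ S.cls y := by
  classical
  obtain ⟨a, ha⟩ := S.exists_eq_sum_superchar (f := fun g => if S.cls g = S.cls y then 1 else 0)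
    fun g h hh => by rw [S.cls_eq g h hh]
  have h : ∀ X : S.parts, S.superchar X (x * y * x⁻¹) = S.superchar X y := fun X =>
    Finset.sum_congr rfl fun χ hχ => by rw [(S.isIrrChar_of_mem X.2 hχ).conj]
  have h₁ := ha (x * y * x⁻¹)
  simp only [h] at h₁
  rw [← ha y, if_pos rfl] at h₁
  by_contra hn
  rw [if_neg fun hc : S.cls (x * y * x⁻¹) = S.cls y => hn (hc ▸ S.mem_cls _)] at h₁
  exact zero_ne_one h₁

theorem inv_mul_mem_derived {g k : G} (hk : k ∈ S.cls g) : g⁻¹ * k ∈ S.derived :=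
  Subgroup.subset_closure ⟨g, Subgroup.mem_top g, k, hk, rfl⟩

theorem commutator_le_derived : commutator G ≤ S.derived := by
  rw [commutator_def, Subgroup.commutator_le]
  intro x _ y _
  have h := S.inv_mul_mem_derived (S.conj_mem_cls y x⁻¹)
  rw [commutatorElement_def]
  simpa [mul_assoc] using h

/-- A supercharacter whose kernel misses part of `[G,S]` is orthogonal to the linear characters
trivial on `[G,S]`. -/
theorem sum_monoidHom_mul_superchar_inv {Z : Finset (G → ℂ)} (hZ : Z ∈ S.parts)
    (hker : ¬ S.derived ≤ charKer (S.superchar Z)) (l : G →* ℂ) (hl : ∀ n ∈ S.derived, l n = 1) :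
    ∑ g, l g * S.superchar Z g⁻¹ = 0 := by
  classical
  have hirr := isIrrChar_of_monoidHom l
  rw [S.sum_char_mul_superchar_inv hirr hZ, if_neg]
  intro hlZ
  have hconst : ∀ g, ∀ h ∈ S.cls g, S.superchar Z 1 * l h - S.superchar Z h =
      S.superchar Z 1 * l g - S.superchar Z g := fun g h hh => by
    have h₁ : l h = l g := by
      rw [← mul_inv_cancel_left g h, map_mul, hl _ (S.inv_mul_mem_derived hh), mul_one]
    rw [h₁, S.superchar_cls hZ hh]
  obtain ⟨a, ha⟩ := S.exists_eq_sum_superchar hconst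
  have ha0 := S.coeff_eq_zero (a := a) fun X hX => by
    simp only [← ha, sub_mul, Finset.sum_sub_distrib, mul_assoc, ← Finset.mul_sum]
    rw [S.sum_char_mul_superchar_inv hirr hX, S.sum_superchar_mul_superchar_inv hZ hX]
    by_cases h : Z = X
    · subst h
      simp [hlZ, mul_comm]
    · rw [if_neg h, if_neg fun hlX => h (S.eq_of_mem_of_mem hZ hX hlZ hlX)]
      simp
  have heq : ∀ g, S.superchar Z g = S.superchar Z 1 * l g := fun g => by
    have := ha g
    simp only [ha0, zero_mul, Finset.sum_const_zero] at this
    exact (sub_eq_zero.1 this).symm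
  refine hker fun n hn h => ?_
  rw [heq, heq h, map_mul, hl n hn, one_mul]

/-- A supercharacter whose kernel misses part of `[G,S]` sums to zero over cosets of `[G,S]`. -/
theorem sum_coset_superchar_eq_zero {Z : Finset (G → ℂ)} (hZ : Z ∈ S.parts)
    (hker : ¬ S.derived ≤ charKer (S.superchar Z)) (g : G)
    [DecidablePred fun h => g⁻¹ * h ∈ S.derived] :
    ∑ h with g⁻¹ * h ∈ S.derived, S.superchar Z h = 0 := by
  classical
  have hn : S.derived.Normal := Subgroup.Normal.of_commutator_le _ S.commutator_le_derived
  have hcomm : IsMulCommutative (G ⧸ S.derived) :=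
    Subgroup.Normal.quotient_commutative_iff_commutator_le.2 S.commutator_le_derived
  let _ : CommGroup (G ⧸ S.derived) :=
    { (inferInstance : Group (G ⧸ S.derived)) with mul_comm := hcomm.is_comm.comm }
  let A := Additive (G ⧸ S.derived)
  let q : G → A := fun h => Additive.ofMul (h : G ⧸ S.derived)
  have hq : ∀ h, q g - q h = 0 ↔ g⁻¹ * h ∈ S.derived := fun h => by
    rw [sub_eq_zero, ← QuotientGroup.eq]
    rfl
  have hψ : ∀ ψ : AddChar A ℂ, ∑ h, ψ (q g - q h) * S.superchar Z h = 0 := fun ψ => by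
    let l : G →* ℂ := ψ.toMonoidHom.comp
      ((AddMonoidHom.toMultiplicative (AddMonoidHom.id A)).comp
        (QuotientGroup.mk' S.derived))
    have hl : ∀ h, l h = ψ (q h) := fun h => rfl
    have hl₁ : ∀ n ∈ S.derived, l n = 1 := fun n hn => by
      have : q n = 0 := (QuotientGroup.eq_one_iff n).2 hn
      rw [hl, this, AddChar.map_zero_eq_one]
    have hs := S.sum_monoidHom_mul_superchar_inv hZ hker l hl₁
    rw [← Equiv.sum_comp (Equiv.inv G)] at hs
    calc ∑ h, ψ (q g - q h) * S.superchar Z h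
        = ψ (q g) * ∑ h, l h⁻¹ * S.superchar Z h⁻¹⁻¹ := by
          rw [Finset.mul_sum]
          refine Finset.sum_congr rfl fun h _ => ?_
          have : q h⁻¹ = - q h := rfl
          rw [hl, this, sub_eq_add_neg, AddChar.map_add_eq_mul, inv_inv, mul_assoc]
      _ = 0 := by
          simp only [Equiv.inv_apply] at hs
          rw [hs, mul_zero]
  have h := Finset.sum_congr rfl fun ψ (_ : ψ ∈ (Finset.univ : Finset (AddChar A ℂ))) => hψ ψ
  rw [Finset.sum_comm] at h
  simp only [← Finset.sum_mul, AddChar.sum_apply_eq_ite, hq, ite_mul, zero_mul,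
    Finset.sum_const_zero] at h
  rw [← Finset.sum_filter, ← Finset.mul_sum] at h
  exact (mul_eq_zero.1 h).resolve_left (Nat.cast_ne_zero.2 Fintype.card_ne_zero)

/-- A function constant on the `S`-classes and orthogonal to all supercharacters vanishes. -/
theorem eq_zero_of_sum_mul_superchar {f : G → ℂ} (hf : ∀ g, ∀ h ∈ S.cls g, f h = f g)
    (h : ∀ X ∈ S.parts, ∑ g, f g * S.superchar X g = 0) (g : G) : f g = 0 := by
  classical
  obtain ⟨a, ha⟩ := S.exists_eq_sum_superchar (f := fun x => star (f x)) fun x y hy => by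
    rw [hf x y hy]
  have h₀ : ∑ x, f x * star (f x) = 0 := by
    simp only [ha, Finset.mul_sum]
    rw [Finset.sum_comm]
    refine Finset.sum_eq_zero fun X _ => ?_
    have := congrArg (a X * ·) (h X X.2)
    simp only [Finset.mul_sum, mul_zero] at this
    rw [← this]
    exact Finset.sum_congr rfl fun _ _ => by ring
  have h₁ : ∑ x, ‖f x‖ ^ 2 = 0 := by
    have : ((∑ x, ‖f x‖ ^ 2 : ℝ) : ℂ) = 0 := by
      rw [← h₀]
      push_cast
      exact Finset.sum_congr rfl fun x _ => (Complex.mul_conj' (f x)).symm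
    exact_mod_cast this
  rw [Finset.sum_eq_zero_iff_of_nonneg fun _ _ => by positivity] at h₁
  simpa using h₁ g (Finset.mem_univ g)

end SCT

/-- `g` is an `S`-Camina element iff `|Cl_S(g)| = |[G,S]|`. -/
theorem caminaElt_iff_card_cls_eq (S : SCT G) (g : G) :
    S.IsCaminaElt g ↔ Nat.card (S.cls g) = Nat.card S.derived := by
  classical
  set K : Finset G := {h | h ∈ S.cls g} with hK
  set C : Finset G := {h | g⁻¹ * h ∈ S.derived} with hC
  have hKC : K ⊆ C := fun h hh => by
    simp only [hK, hC, Finset.mem_filter_univ] at hh ⊢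
    exact S.inv_mul_mem_derived hh
  have hcardK : Nat.card (S.cls g) = K.card := by
    rw [Nat.card_eq_fintype_card, Fintype.card_subtype]
  have hcardC : Nat.card S.derived = C.card := by
    rw [Nat.card_eq_fintype_card, Fintype.card_subtype]
    refine Finset.card_bij (fun h _ => g * h) ?_ (fun _ _ _ _ h => mul_left_cancel h) ?_
    · simp [hC]
    · exact fun b hb => ⟨g⁻¹ * b, by simpa [hC] using hb, by simp⟩
  have hgK : g ∈ K := by simpa [hK] using S.mem_cls g
  have hK₀ : (K.card : ℂ) ≠ 0 := Nat.cast_ne_zero.2 (Finset.card_ne_zero_of_mem hgK)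
  have hC₀ : (C.card : ℂ) ≠ 0 := Nat.cast_ne_zero.2 (Finset.card_ne_zero_of_mem (hKC hgK))
  have hsumK : ∀ X ∈ S.parts, ∑ h ∈ K, S.superchar X h = K.card * S.superchar X g := by
    intro X hX
    rw [Finset.sum_congr rfl fun h hh => S.superchar_cls hX (by simpa [hK] using hh),
      Finset.sum_const, nsmul_eq_mul]
  rw [hcardK, hcardC]
  constructor
  · intro hcam
    have hsumC : ∀ X ∈ S.parts, ∑ h ∈ C, S.superchar X h = C.card * S.superchar X g := by
      intro X hX
      by_cases hker : S.derived ≤ charKer (S.superchar X)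
      · have hn : S.derived.Normal := Subgroup.Normal.of_commutator_le _ S.commutator_le_derived
        rw [Finset.sum_congr rfl fun h hh => ?_, Finset.sum_const, nsmul_eq_mul]
        have hh' : g⁻¹ * h ∈ S.derived := by simpa [hC] using hh
        have := hker (hn.mem_comm hh') g
        simpa using this
      · rw [hC, S.sum_coset_superchar_eq_zero hX hker g, hcam _ ⟨⟨X, hX, rfl⟩, hker⟩, mul_zero]
    have hcls : ∀ x, ∀ y ∈ S.cls x, (y ∈ K ↔ x ∈ K) ∧ (y ∈ C ↔ x ∈ C) := by
      intro x y hy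
      simp only [hK, hC, Finset.mem_filter_univ]
      refine ⟨⟨fun h => ?_, fun h => ?_⟩, ?_⟩
      · rw [← S.cls_eq g y h, S.cls_eq x y hy]
        exact S.mem_cls x
      · rwa [← S.cls_eq g x h]
      · rw [← Subgroup.mul_mem_cancel_right S.derived (S.inv_mul_mem_derived hy) (y := g⁻¹ * x),
          mul_assoc, mul_inv_cancel_left]
    have h := S.eq_zero_of_sum_mul_superchar
      (f := fun x => (if x ∈ K then (K.card : ℂ)⁻¹ else 0) - if x ∈ C then (C.card : ℂ)⁻¹ else 0)
      (fun x y hy => by simp only [hcls x y hy]) (fun X hX => by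
        simp only [sub_mul, Finset.sum_sub_distrib, ite_mul, zero_mul]
        rw [Finset.sum_ite_mem, Finset.sum_ite_mem, Finset.univ_inter, Finset.univ_inter,
          ← Finset.mul_sum, ← Finset.mul_sum, hsumK X hX, hsumC X hX,
          inv_mul_cancel_left₀ hK₀, inv_mul_cancel_left₀ hC₀, sub_self]) g
    simp only [if_pos hgK, if_pos (hKC hgK), sub_eq_zero, inv_inj, Nat.cast_inj] at h
    exact h
  · rintro hcard f ⟨⟨X, hX, rfl⟩, hker⟩
    have hEq : K = C := Finset.eq_of_subset_of_card_le hKC hcard.ge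
    have h := hsumK X hX
    rw [hEq, hC, S.sum_coset_superchar_eq_zero hX hker g] at h
    exact (mul_eq_zero.1 h.symm).resolve_left hC₀
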